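/- Let B > 0, ε ∈ (0,1), w ≥ 0, and let θ be a real number with 0 ≤ θ ≤ w/(5B). Let X ⊆ V, let y_1, …, y_q be distinct elements of V forming Y = {y_1,…,y_q} with prefixes Y^j = {y_1,…,y_j} (for e = y_j write Y^{<e} = Y^{j−1}), with X ∩ Y = ∅, and let O' ⊆ V with c(O') ≤ ε·B. Assume: (i) f(y_j|Y^{j−1}) ≥ 0 for every j; (ii) every e ∈ O' ∩ Y satisfies f(e|X) ≤ f(e|Y^{<e}); (iii) every e ∈ O' \ (X ∪ Y) satisfies f(e|X) ≤ θ·c(e). Then f(O' ∪ X) ≤ f(X) + f(Y) + ε·w/5. -/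

import Mathlib

/-- The prefix set `Y^j = {y_1, …, y_j}` (0-indexed: `{y 0, …, y (j-1)}`). -/
def prefSet {V : Type*} [DecidableEq V] (y : ℕ → V) (j : ℕ) : Finset V :=
  (Finset.range j).image y

/-- The gain of adding `S` to `X` is at most the sum of the marginal gains over `X`. -/
theorem union_sub_le_sum_marginals {V : Type*} [DecidableEq V] (f : Finset V → ℝ)
    (hsub : ∀ A B : Finset V, A ⊆ B → ∀ e ∉ B,
      f (insert e A) - f A ≥ f (insert e B) - f B) (X S : Finset V) :
    f (S ∪ X) - f X ≤ ∑ e ∈ S, (f (insert e X) - f X) := by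
  induction S using Finset.induction_on with
  | empty => simp
  | insert a S ha ih =>
    rw [Finset.sum_insert ha, Finset.insert_union]
    by_cases haX : a ∈ X
    · rw [Finset.insert_eq_of_mem haX, Finset.insert_eq_of_mem (Finset.mem_union_right S haX)]
      linarith
    · have := hsub X (S ∪ X) Finset.subset_union_right a (by simp [ha, haX])
      linarith

/-- The marginal gains along the prefixes telescope. -/
theorem sum_prefSet_marginals {V : Type*} [DecidableEq V] (f : Finset V → ℝ) (y : ℕ → V) (q : ℕ) :
    ∑ j ∈ Finset.range q, (f (insert (y j) (prefSet y j)) - f (prefSet y j)) =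
      f (prefSet y q) - f ∅ := by
  have hsucc (j : ℕ) : insert (y j) (prefSet y j) = prefSet y (j + 1) := by
    rw [prefSet, prefSet, Finset.range_add_one, Finset.image_insert]
  simp_rw [hsucc]
  exact Finset.sum_range_sub (fun j => f (prefSet y j)) q

/-- With `f` submodular and normalized, positive costs `c`,
`B > 0`, `ε ∈ (0,1)`, `w ≥ 0`, `0 ≤ θ ≤ w/(5B)`, `X ⊆ V`,
`Y = {y_1,…,y_q}` disjoint from `X` built with non-negative marginal gains,
and `O' ⊆ V` with `c(O') ≤ ε·B` satisfying the stated exchange and threshold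
conditions, we have `f(O' ∪ X) ≤ f(X) + f(Y) + ε·w/5`. -/
theorem smk_statement_9 {V : Type*} [Fintype V] [DecidableEq V]
    (f : Finset V → ℝ) (c : V → ℝ)
    (hsub : ∀ A B : Finset V, A ⊆ B → ∀ e ∉ B,
      f (insert e A) - f A ≥ f (insert e B) - f B)
    (hnorm : f ∅ = 0) (hc : ∀ e : V, 0 < c e)
    (B ε w θ : ℝ) (hB : 0 < B) (hε0 : 0 < ε) (hε1 : ε < 1) (hw : 0 ≤ w)
    (hθ0 : 0 ≤ θ) (hθ : θ ≤ w / (5 * B))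
    (X : Finset V)
    (q : ℕ) (y : ℕ → V) (hinjy : Set.InjOn y (Set.Iio q))
    (Y : Finset V) (hY : Y = prefSet y q) (hXY : Disjoint X Y)
    (O' : Finset V) (hO' : ∑ e ∈ O', c e ≤ ε * B)
    -- (i) non-negative marginal gains along Y
    (hgy : ∀ j < q, 0 ≤ f (insert (y j) (prefSet y j)) - f (prefSet y j))
    -- (ii) exchange condition for elements of O' ∩ Y
    (hex : ∀ j < q, y j ∈ O' →
      f (insert (y j) X) - f X ≤ f (insert (y j) (prefSet y j)) - f (prefSet y j))
    -- (iii) threshold condition outside X ∪ Y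
    (hout : ∀ e ∈ O' \ (X ∪ Y), f (insert e X) - f X ≤ θ * c e) :
    f (O' ∪ X) ≤ f X + f Y + ε * w / 5 := by
  subst hY
  have hsplit : O' ∪ X = (O' ∩ prefSet y q ∪ O' \ (X ∪ prefSet y q)) ∪ X := by
    ext e
    simp only [Finset.mem_union, Finset.mem_inter, Finset.mem_sdiff]
    tauto
  have hdisj : Disjoint (O' ∩ prefSet y q) (O' \ (X ∪ prefSet y q)) := by
    rw [Finset.disjoint_left]
    intro e
    simp only [Finset.mem_union, Finset.mem_inter, Finset.mem_sdiff]
    tauto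
  have hin : ∑ e ∈ O' ∩ prefSet y q, (f (insert e X) - f X) ≤ f (prefSet y q) := by
    have himage : O' ∩ prefSet y q = ((Finset.range q).filter (y · ∈ O')).image y := by
      ext e
      simp only [prefSet, Finset.mem_inter, Finset.mem_image, Finset.mem_range, Finset.mem_filter]
      constructor
      · rintro ⟨he, j, hj, rfl⟩
        exact ⟨j, ⟨hj, he⟩, rfl⟩
      · rintro ⟨j, ⟨hj, he⟩, rfl⟩
        exact ⟨he, j, hj, rfl⟩
    have hinj : Set.InjOn y ((Finset.range q).filter (y · ∈ O')) :=
      hinjy.mono fun j hj =>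
        Finset.mem_range.mp (Finset.mem_filter.mp (Finset.mem_coe.mp hj)).1
    rw [himage, Finset.sum_image hinj]
    calc ∑ j ∈ (Finset.range q).filter (y · ∈ O'), (f (insert (y j) X) - f X)
        ≤ ∑ j ∈ (Finset.range q).filter (y · ∈ O'),
            (f (insert (y j) (prefSet y j)) - f (prefSet y j)) :=
          Finset.sum_le_sum fun j hj => by
            rw [Finset.mem_filter, Finset.mem_range] at hj
            exact hex j hj.1 hj.2
      _ ≤ ∑ j ∈ Finset.range q, (f (insert (y j) (prefSet y j)) - f (prefSet y j)) :=
          Finset.sum_le_sum_of_subset_of_nonneg (Finset.filter_subset _ _)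
            fun j hj _ => hgy j (Finset.mem_range.mp hj)
      _ = f (prefSet y q) := by rw [sum_prefSet_marginals, hnorm, sub_zero]
  have hrest : ∑ e ∈ O' \ (X ∪ prefSet y q), (f (insert e X) - f X) ≤ ε * w / 5 := by
    calc ∑ e ∈ O' \ (X ∪ prefSet y q), (f (insert e X) - f X)
        ≤ ∑ e ∈ O' \ (X ∪ prefSet y q), θ * c e := Finset.sum_le_sum hout
      _ ≤ ∑ e ∈ O', θ * c e :=
          Finset.sum_le_sum_of_subset_of_nonneg Finset.sdiff_subset
            fun e _ _ => mul_nonneg hθ0 (hc e).le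
      _ = θ * ∑ e ∈ O', c e := (Finset.mul_sum _ _ _).symm
      _ ≤ θ * (ε * B) := mul_le_mul_of_nonneg_left hO' hθ0
      _ ≤ w / (5 * B) * (ε * B) := mul_le_mul_of_nonneg_right hθ (by positivity)
      _ = ε * w / 5 := by field_simp
  have h := union_sub_le_sum_marginals f hsub X (O' ∩ prefSet y q ∪ O' \ (X ∪ prefSet y q))
  rw [← hsplit, Finset.sum_union hdisj] at h
  linarith
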